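/- Let 1 ≤ p < q ≤ ∞ and let id : ℓ_p^m → ℓ_q^m be the natural identity embedding. Then there exist positive constants c₁, c₂, depending only on p and q (independent of m and n), such that for all m, n ∈ ℕ one has c₁·A(m,n) ≤ e_n(id) ≤ c₂·A(m,n), where A(m,n) = 1 if n ≤ log₂ m; A(m,n) = (log₂(m/n + 1)/n)^{1/p − 1/q} if log₂ m ≤ n ≤ m; and A(m,n) = 2^{−n/m}·m^{1/q − 1/p} if n ≥ m (with the convention 1/∞ = 0). -/

import Mathlib

open Metric Set
open scoped ENNReal

/-- The `n`-th (dyadic) entropy number of a bounded linear operator `T : X → Y`: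
the infimum of all `ε > 0` such that the image of the closed unit ball of `X`
can be covered by `2 ^ (n - 1)` closed balls of radius `ε` in `Y`. -/
noncomputable def entropyNum {X Y : Type*} [NormedAddCommGroup X] [NormedSpace ℝ X]
    [NormedAddCommGroup Y] [NormedSpace ℝ Y] (n : ℕ) (T : X →L[ℝ] Y) : ℝ :=
  sInf {ε : ℝ | 0 < ε ∧ ∃ S : Finset Y, S.card ≤ 2 ^ (n - 1) ∧
    T '' closedBall 0 1 ⊆ ⋃ y ∈ S, closedBall y ε}

/-- The `n`-th (dyadic) inner entropy number of a bounded linear operator `T : X → Y`: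
the supremum of all `ε > 0` such that there are `2 ^ (n - 1) + 1` points in the closed
unit ball of `X` whose images under `T` are pairwise at distance at least `2 * ε`. -/
noncomputable def innerEntropyNum {X Y : Type*} [NormedAddCommGroup X] [NormedSpace ℝ X]
    [NormedAddCommGroup Y] [NormedSpace ℝ Y] (n : ℕ) (T : X →L[ℝ] Y) : ℝ :=
  sSup {ε : ℝ | 0 < ε ∧ ∃ x : Fin (2 ^ (n - 1) + 1) → X, (∀ i, ‖x i‖ ≤ 1) ∧
    ∀ i j, i ≠ j → 2 * ε ≤ ‖T (x i) - T (x j)‖}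

/-- The finite set of integer vectors whose `ℓ_1`-norm is at most `K`. -/
noncomputable def latticeBall (m : ℕ) (K : ℝ) : Finset (Fin m → ℤ) :=
  (Fintype.piFinset fun _ => Finset.Icc (-(⌊K⌋₊ : ℤ)) ⌊K⌋₊).filter
    fun z => ∑ i, |(z i : ℝ)| ≤ K

theorem mem_latticeBall {m : ℕ} {K : ℝ} {z : Fin m → ℤ} :
    z ∈ latticeBall m K ↔ ∑ i, |(z i : ℝ)| ≤ K := by
  refine ⟨fun h => (Finset.mem_filter.1 h).2, fun h => Finset.mem_filter.2 ⟨?_, h⟩⟩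
  rw [Fintype.mem_piFinset]
  intro i
  have hi : |(z i : ℝ)| ≤ K :=
    (Finset.single_le_sum (f := fun i => |(z i : ℝ)|) (fun _ _ => abs_nonneg _)
      (Finset.mem_univ i)).trans h
  have hnat : (z i).natAbs ≤ ⌊K⌋₊ := by
    apply Nat.le_floor
    rwa [Nat.cast_natAbs, Int.cast_abs]
  rw [Finset.mem_Icc]
  omega

theorem sum_pow_natAbs_le {u : ℝ} (hu0 : 0 ≤ u) (hu1 : u < 1) (N : ℕ) :
    ∑ z ∈ Finset.Icc (-(N : ℤ)) N, u ^ z.natAbs ≤ (1 + u) / (1 - u) := by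
  have heven : Function.Even fun z : ℤ => u ^ z.natAbs := fun z => by simp
  rw [Finset.sum_Icc_of_even_eq_range heven N]
  simp only [Int.natAbs_natCast, Int.natAbs_zero, pow_zero, nsmul_eq_mul, Nat.cast_ofNat]
  have hgeom : ∑ k ∈ Finset.range (N + 1), u ^ k ≤ (1 - u)⁻¹ := by
    rw [← tsum_geometric_of_lt_one hu0 hu1]
    exact (summable_geometric_of_lt_one hu0 hu1).sum_le_tsum _ fun _ _ => by positivity
  have h : (1 + u) / (1 - u) = 2 * (1 - u)⁻¹ - 1 := by
    have : 1 - u ≠ 0 := by linarith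
    field_simp
    ring
  linarith

/-- Exponential-weight bound for the number of lattice points in an `ℓ_1`-ball. -/
theorem card_latticeBall_le {u : ℝ} (hu0 : 0 < u) (hu1 : u < 1) (m : ℕ) (K : ℝ) :
    ((latticeBall m K).card : ℝ) ≤ u ^ (-K) * ((1 + u) / (1 - u)) ^ m := by
  have hweight : ∀ z ∈ latticeBall m K, (1 : ℝ) ≤ u ^ (-K) * ∏ i, u ^ (z i).natAbs := by
    intro z hz
    have hz' := mem_latticeBall.1 hz
    have hprod : ∏ i, u ^ (z i).natAbs = u ^ (∑ i, |(z i : ℝ)|) := by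
      rw [Finset.prod_pow_eq_pow_sum, ← Real.rpow_natCast]
      congr 1
      push_cast
      simp [Nat.cast_natAbs]
    rw [hprod, ← Real.rpow_add hu0]
    exact Real.one_le_rpow_of_pos_of_le_one_of_nonpos hu0 hu1.le (by linarith)
  calc ((latticeBall m K).card : ℝ) = ∑ _z ∈ latticeBall m K, (1 : ℝ) := by simp
    _ ≤ ∑ z ∈ latticeBall m K, u ^ (-K) * ∏ i, u ^ (z i).natAbs := Finset.sum_le_sum hweight
    _ ≤ ∑ z ∈ Fintype.piFinset fun _ : Fin m => Finset.Icc (-(⌊K⌋₊ : ℤ)) ⌊K⌋₊,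
          u ^ (-K) * ∏ i, u ^ (z i).natAbs :=
        Finset.sum_le_sum_of_subset_of_nonneg (Finset.filter_subset _ _)
          fun _ _ _ => by positivity
    _ = u ^ (-K) * (∑ z ∈ Finset.Icc (-(⌊K⌋₊ : ℤ)) ⌊K⌋₊, u ^ z.natAbs) ^ m := by
        rw [← Finset.mul_sum, Finset.sum_prod_piFinset _ fun _ (z : ℤ) => u ^ z.natAbs]
        simp
    _ ≤ u ^ (-K) * ((1 + u) / (1 - u)) ^ m := by
        gcongr
        exact sum_pow_natAbs_le hu0.le hu1 _

theorem card_latticeBall_le_of_le {m : ℕ} {K : ℝ} (hK : 0 < K) (hKm : K ≤ m) :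
    ((latticeBall m K).card : ℝ) ≤ (16 * m / K) ^ K := by
  have hm : (0 : ℝ) < m := hK.trans_le hKm
  set u : ℝ := K / (2 * m) with hu
  have hu0 : 0 < u := by positivity
  have hu1 : u ≤ 1 / 2 := by
    rw [hu, div_le_iff₀ (by positivity)]
    linarith
  have hexp : (1 + u) / (1 - u) ≤ Real.exp (4 * u) := by
    have h1 : (1 + u) / (1 - u) ≤ 4 * u + 1 := by
      rw [div_le_iff₀ (by linarith)]
      nlinarith
    exact h1.trans (Real.add_one_le_exp _)
  have hexp2 : Real.exp 2 ≤ 8 := by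
    have h := Real.exp_one_lt_d9
    have h2 : Real.exp 2 = Real.exp 1 * Real.exp 1 := by
      rw [← Real.exp_add]
      norm_num
    have := Real.exp_pos 1
    nlinarith
  calc ((latticeBall m K).card : ℝ) ≤ u ^ (-K) * ((1 + u) / (1 - u)) ^ m :=
        card_latticeBall_le hu0 (by linarith) m K
    _ ≤ u ^ (-K) * Real.exp (4 * u) ^ m := by
        gcongr
        exact div_nonneg (by linarith) (by linarith)
    _ = (2 * m / K) ^ K * (Real.exp 2) ^ K := by
        congr 1
        · rw [Real.rpow_neg hu0.le, ← Real.inv_rpow hu0.le, hu, inv_div]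
        · rw [← Real.exp_nat_mul, ← Real.exp_mul]
          congr 1
          rw [hu]
          field_simp
          ring
    _ ≤ (2 * m / K) ^ K * 8 ^ K := by gcongr
    _ = (16 * m / K) ^ K := by
        rw [← Real.mul_rpow (by positivity) (by positivity)]
        congr 1
        ring

theorem card_latticeBall_mul_le {m : ℕ} {t : ℝ} (ht : 1 ≤ t) :
    ((latticeBall m (m * t)).card : ℝ) ≤ (12 * t) ^ m := by
  set x : ℝ := 1 / (2 * t) with hx
  have hx0 : 0 < x := by positivity
  have hx1 : x ≤ 1 / 2 := by
    rw [hx, div_le_div_iff₀ (by positivity) (by positivity)]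
    linarith
  have hxt : 2 * x * t = 1 := by
    rw [hx]
    field_simp
  have hinv : (1 - x)⁻¹ ≤ Real.exp (2 * x) := by
    have h1 : (1 - x)⁻¹ ≤ 2 * x + 1 := by
      rw [inv_le_iff_one_le_mul₀ (by linarith)]
      nlinarith
    exact h1.trans (Real.add_one_le_exp _)
  calc ((latticeBall m (m * t)).card : ℝ)
      ≤ (1 - x) ^ (-(m * t)) * ((1 + (1 - x)) / (1 - (1 - x))) ^ m :=
        card_latticeBall_le (by linarith) (by linarith) m _
    _ ≤ Real.exp 1 ^ m * (4 * t) ^ m := by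
        refine mul_le_mul ?_ (pow_le_pow_left₀ ?_ ?_ m) (pow_nonneg ?_ m) (by positivity)
        · rw [Real.rpow_neg (by linarith), ← Real.inv_rpow (by linarith)]
          calc (1 - x)⁻¹ ^ (m * t) ≤ Real.exp (2 * x) ^ (m * t) := by
                have : 0 ≤ (1 - x)⁻¹ := inv_nonneg.2 (by linarith)
                gcongr
            _ = Real.exp 1 ^ m := by
                rw [← Real.exp_mul, ← Real.exp_nat_mul]
                congr 1
                linear_combination (m : ℝ) * hxt
        · exact div_nonneg (by linarith) (by linarith)
        · rw [div_le_iff₀ (by linarith)]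
          nlinarith
        · exact div_nonneg (by linarith) (by linarith)
    _ ≤ (12 * t) ^ m := by
        rw [← mul_pow]
        have := Real.exp_one_lt_d9
        exact pow_le_pow_left₀ (by positivity) (by nlinarith) m

theorem card_latticeBall_quarter_le (m : ℕ) :
    ((latticeBall m (m / 4)).card : ℝ) ≤ 6 ^ m := by
  calc ((latticeBall m (m / 4)).card : ℝ)
      ≤ (1 / 2) ^ (-((m : ℝ) / 4)) * ((1 + 1 / 2) / (1 - 1 / 2)) ^ m :=
        card_latticeBall_le (by norm_num) (by norm_num) m _
    _ ≤ 2 ^ m * 3 ^ m := by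
        gcongr ?_ * ?_
        · rw [Real.rpow_neg (by norm_num), ← Real.inv_rpow (by norm_num),
            ← Real.rpow_natCast, one_div, inv_inv]
          have := Nat.cast_nonneg (α := ℝ) m
          exact Real.rpow_le_rpow_of_exponent_le (by norm_num) (by linarith)
        · norm_num
    _ = 6 ^ m := by
        rw [← mul_pow]
        norm_num

theorem PiLp.sum_rpow_le_of_norm_le {p : ℝ≥0∞} (hp : 0 < p.toReal) {m : ℕ} {x : Fin m → ℝ}
    {r : ℝ} (hx : ‖WithLp.toLp p x‖ ≤ r) : ∑ i, |x i| ^ p.toReal ≤ r ^ p.toReal := by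
  rw [PiLp.norm_eq_sum hp] at hx
  have hsum : 0 ≤ ∑ i, |x i| ^ p.toReal := by positivity
  have h := Real.rpow_le_rpow (by positivity) hx hp.le
  rwa [one_div, Real.rpow_inv_rpow (by positivity) hp.ne'] at h

theorem PiLp.norm_le_of_sum_rpow_le {p : ℝ≥0∞} (hp : 0 < p.toReal) {m : ℕ} {x : Fin m → ℝ}
    {r : ℝ} (hr : 0 ≤ r) (hx : ∑ i, |x i| ^ p.toReal ≤ r ^ p.toReal) :
    ‖WithLp.toLp p x‖ ≤ r := by
  rw [PiLp.norm_eq_sum hp, one_div]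
  exact (Real.rpow_inv_le_iff_of_pos (by positivity) hr hp).2 hx

theorem PiLp.norm_le_of_abs_le {q : ℝ≥0∞} [hq : Fact (1 ≤ q)] {m : ℕ} {x : Fin m → ℝ}
    {δ : ℝ} (hδ : 0 ≤ δ) (hx : ∀ i, |x i| ≤ δ) :
    ‖WithLp.toLp q x‖ ≤ (m : ℝ) ^ (1 / q.toReal) * δ := by
  rcases eq_or_ne q ∞ with rfl | hq'
  · simpa using (pi_norm_le_iff_of_nonneg hδ).2 hx
  · have hq0 : 0 < q.toReal := ENNReal.toReal_pos (zero_lt_one.trans_le hq.out).ne' hq'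
    apply PiLp.norm_le_of_sum_rpow_le hq0 (by positivity)
    rw [Real.mul_rpow (by positivity) hδ, one_div, Real.rpow_inv_rpow (by positivity) hq0.ne']
    calc ∑ i, |x i| ^ q.toReal ≤ ∑ _i : Fin m, δ ^ q.toReal := by
          gcongr with i
          exact hx i
      _ = m * δ ^ q.toReal := by simp

/-- A vector dominated by a vector of the unit ball of `ℓ_p` and uniformly small
has small `ℓ_q`-norm. -/
theorem PiLp.norm_le_of_abs_le_of_norm_le_one {p q : ℝ≥0∞} [hp : Fact (1 ≤ p)] (hpq : p < q)
    {m : ℕ} {x e : Fin m → ℝ} (hx : ‖WithLp.toLp p x‖ ≤ 1) {κ : ℝ} (hκ : 0 < κ)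
    (hex : ∀ i, |e i| ≤ |x i|) (heκ : ∀ i, |e i| ≤ κ ^ (-(1 / p.toReal))) :
    ‖WithLp.toLp q e‖ ≤ κ ^ (-(1 / p.toReal - 1 / q.toReal)) := by
  have hp0 : 0 < p.toReal := ENNReal.toReal_pos (zero_lt_one.trans_le hp.out).ne' hpq.ne_top
  rcases eq_or_ne q ∞ with rfl | hq'
  · rw [PiLp.norm_toLp, ENNReal.toReal_top, div_zero, sub_zero]
    exact (pi_norm_le_iff_of_nonneg (by positivity)).2 heκ
  · have hpq' : p.toReal < q.toReal := (ENNReal.toReal_lt_toReal hpq.ne_top hq').2 hpq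
    have hq0 : 0 < q.toReal := hp0.trans hpq'
    apply PiLp.norm_le_of_sum_rpow_le hq0 (by positivity)
    have hsum := PiLp.sum_rpow_le_of_norm_le hp0 hx
    rw [Real.one_rpow] at hsum
    calc ∑ i, |e i| ^ q.toReal
        ≤ ∑ i, (κ ^ (-(1 / p.toReal))) ^ (q.toReal - p.toReal) * |x i| ^ p.toReal := by
          apply Finset.sum_le_sum
          intro i _
          calc |e i| ^ q.toReal = |e i| ^ (q.toReal - p.toReal) * |e i| ^ p.toReal := by
                rw [← Real.rpow_add_of_nonneg (abs_nonneg _) (by linarith) hp0.le]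
                congr 1
                ring
            _ ≤ _ := by
                have h1 := heκ i
                have h2 := hex i
                have h3 : 0 ≤ q.toReal - p.toReal := by linarith
                exact mul_le_mul (Real.rpow_le_rpow (abs_nonneg _) h1 h3)
                  (Real.rpow_le_rpow (abs_nonneg _) h2 hp0.le) (by positivity) (by positivity)
      _ = (κ ^ (-(1 / p.toReal))) ^ (q.toReal - p.toReal) * ∑ i, |x i| ^ p.toReal := by
          rw [Finset.mul_sum]
      _ ≤ (κ ^ (-(1 / p.toReal))) ^ (q.toReal - p.toReal) * 1 := by gcongr
      _ = (κ ^ (-(1 / p.toReal - 1 / q.toReal))) ^ q.toReal := by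
          rw [mul_one, ← Real.rpow_mul hκ.le, ← Real.rpow_mul hκ.le]
          congr 1
          field_simp

theorem Int.abs_le_abs_rpow (z : ℤ) {r : ℝ} (hr : 1 ≤ r) : |(z : ℝ)| ≤ |(z : ℝ)| ^ r := by
  rcases eq_or_ne z 0 with rfl | hz
  · simp [Real.rpow_nonneg]
  · apply Real.self_le_rpow_of_one_le _ hr
    exact_mod_cast Int.one_le_abs hz

theorem sum_abs_le_of_norm_le {q : ℝ≥0∞} [hq : Fact (1 ≤ q)] {m : ℕ} {w : Fin m → ℤ} {K : ℝ}
    (hK : 0 ≤ K) (hw : ‖WithLp.toLp q fun i => (w i : ℝ)‖ ≤ K ^ (1 / q.toReal) / 4) :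
    ∑ i, |(w i : ℝ)| ≤ K / 4 := by
  rcases eq_or_ne q ∞ with rfl | hq'
  · have hw0 : ∀ i, w i = 0 := by
      intro i
      have hi := (norm_le_pi_norm (fun i => (w i : ℝ)) i).trans
        ((PiLp.norm_toLp (fun i => (w i : ℝ))).symm.le.trans hw)
      by_contra hne
      have h1 : (1 : ℝ) ≤ |(w i : ℝ)| := by exact_mod_cast Int.one_le_abs hne
      rw [Real.norm_eq_abs] at hi
      norm_num at hi
      linarith
    simpa [hw0] using div_nonneg hK (by norm_num)
  · have hq1 : 1 ≤ q.toReal := by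
      simpa using ENNReal.toReal_mono hq' hq.out
    have hq0 : 0 < q.toReal := by linarith
    calc ∑ i, |(w i : ℝ)| ≤ ∑ i, |(w i : ℝ)| ^ q.toReal :=
          Finset.sum_le_sum fun i _ => Int.abs_le_abs_rpow _ hq1
      _ ≤ (K ^ (1 / q.toReal) / 4) ^ q.toReal := PiLp.sum_rpow_le_of_norm_le hq0 hw
      _ = K / 4 ^ q.toReal := by
          rw [Real.div_rpow (by positivity) (by norm_num), one_div,
            Real.rpow_inv_rpow hK hq0.ne']
      _ ≤ K / 4 := by
          gcongr
          exact Real.self_le_rpow_of_one_le (by norm_num) hq1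

/-- Rounding a real number towards zero. -/
theorem exists_int_round_toward_zero (x : ℝ) :
    ∃ z : ℤ, |(z : ℝ)| ≤ |x| ∧ |x - z| ≤ 1 ∧ |x - z| ≤ |x| := by
  rcases le_total 0 x with hx | hx
  · have h1 := Int.floor_le x
    have h2 := (Int.lt_floor_add_one x).le
    have h3 : (0 : ℝ) ≤ ⌊x⌋ := by exact_mod_cast Int.floor_nonneg.2 hx
    refine ⟨⌊x⌋, ?_, ?_, ?_⟩
    · rwa [abs_of_nonneg h3, abs_of_nonneg hx]
    · rw [abs_of_nonneg (by linarith)]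
      linarith
    · rw [abs_of_nonneg (by linarith), abs_of_nonneg hx]
      linarith
  · have h1 := Int.le_ceil x
    have h2 := (Int.ceil_lt_add_one x).le
    have h3 : (⌈x⌉ : ℝ) ≤ 0 := by exact_mod_cast Int.ceil_le.2 (by simpa using hx)
    refine ⟨⌈x⌉, ?_, ?_, ?_⟩
    · rw [abs_of_nonpos h3, abs_of_nonpos hx]
      linarith
    · rw [abs_of_nonpos (by linarith)]
      linarith
    · rw [abs_of_nonpos (by linarith), abs_of_nonpos hx]
      linarith

theorem exists_int_vector_round {m : ℕ} (x : Fin m → ℝ) {δ : ℝ} (hδ : 0 < δ) :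
    ∃ z : Fin m → ℤ, (∀ i, |(z i : ℝ)| ≤ |x i| / δ) ∧ (∀ i, |x i - δ * z i| ≤ δ) ∧
      ∀ i, |x i - δ * z i| ≤ |x i| := by
  choose z hz using fun i => exists_int_round_toward_zero (x i / δ)
  have herr : ∀ i, |x i - δ * z i| = δ * |x i / δ - z i| := by
    intro i
    rw [← abs_of_pos hδ, ← abs_mul, abs_of_pos hδ]
    congr 1
    field_simp
  have habs : ∀ i, |x i / δ| = |x i| / δ := fun i => by rw [abs_div, abs_of_pos hδ]
  refine ⟨z, fun i => ?_, fun i => ?_, fun i => ?_⟩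
  · rw [← habs]
    exact (hz i).1
  · rw [herr]
    nlinarith [(hz i).2.1]
  · have h := (hz i).2.2
    rw [habs, le_div_iff₀ hδ] at h
    rw [herr]
    linarith

section EntropyNumbers

variable {X Y : Type*} [NormedAddCommGroup X] [NormedSpace ℝ X] [NormedAddCommGroup Y]
  [NormedSpace ℝ Y]

theorem entropyNum_le {n : ℕ} {T : X →L[ℝ] Y} {ε : ℝ} (hε : 0 < ε) {S : Finset Y}
    (hS : S.card ≤ 2 ^ (n - 1)) (hcover : ∀ x, ‖x‖ ≤ 1 → ∃ y ∈ S, ‖T x - y‖ ≤ ε) :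
    entropyNum n T ≤ ε := by
  refine csInf_le ⟨0, fun _ h => h.1.le⟩ ⟨hε, S, hS, ?_⟩
  rintro _ ⟨x, hx, rfl⟩
  obtain ⟨y, hy, hxy⟩ := hcover x (by simpa using hx)
  exact Set.mem_biUnion hy (by simpa [dist_eq_norm] using hxy)

theorem le_entropyNum {n : ℕ} {T : X →L[ℝ] Y} {c : ℝ}
    (h : ∀ (ε : ℝ) (S : Finset Y), 0 < ε → S.card ≤ 2 ^ (n - 1) →
      (∀ x, ‖x‖ ≤ 1 → ∃ y ∈ S, ‖T x - y‖ ≤ ε) → c ≤ ε) :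
    c ≤ entropyNum n T := by
  apply le_csInf
  · refine ⟨‖T‖ + 1, by positivity, {0}, by simp [Nat.one_le_two_pow], ?_⟩
    rintro _ ⟨x, hx, rfl⟩
    have hx' : ‖x‖ ≤ 1 := by simpa using hx
    have hTx := (T.le_opNorm x).trans (mul_le_of_le_one_right (norm_nonneg T) hx')
    simp only [Finset.mem_singleton, Set.iUnion_iUnion_eq_left, mem_closedBall, dist_zero_right]
    linarith
  · rintro ε ⟨hε, S, hS, hcover⟩
    refine h ε S hε hS fun x hx => ?_
    have hmem := hcover ⟨x, by simpa using hx, rfl⟩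
    simpa [dist_eq_norm] using hmem

theorem entropyNum_antitone (T : X →L[ℝ] Y) {k n : ℕ} (hkn : k ≤ n) :
    entropyNum n T ≤ entropyNum k T :=
  le_entropyNum fun _ _ hε hS hcover =>
    entropyNum_le hε (hS.trans (Nat.pow_le_pow_right two_pos (by omega))) hcover

end EntropyNumbers

theorem one_le_toReal_of_lt {p q : ℝ≥0∞} [hp : Fact (1 ≤ p)] (hpq : p < q) : 1 ≤ p.toReal := by
  simpa using ENNReal.toReal_mono hpq.ne_top hp.out

section Identity

variable {p q : ℝ≥0∞} [hp : Fact (1 ≤ p)] [hq : Fact (1 ≤ q)] {m n : ℕ}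
  {T : PiLp p (fun _ : Fin m => ℝ) →L[ℝ] PiLp q (fun _ : Fin m => ℝ)}

/-- Covering by a lattice: rounding towards zero in `δ ℤ^m`. -/
theorem entropyNum_le_of_lattice (hT : ∀ x i, T x i = x i) {δ K ε : ℝ} (hδ : 0 < δ) (hε : 0 < ε)
    (hcard : (latticeBall m K).card ≤ 2 ^ (n - 1))
    (hround : ∀ (x : Fin m → ℝ) (z : Fin m → ℤ), ‖WithLp.toLp p x‖ ≤ 1 →
      (∀ i, |(z i : ℝ)| ≤ |x i| / δ) → (∀ i, |x i - δ * z i| ≤ δ) →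
      (∀ i, |x i - δ * z i| ≤ |x i|) →
        ∑ i, |(z i : ℝ)| ≤ K ∧ ‖WithLp.toLp q fun i => x i - δ * z i‖ ≤ ε) :
    entropyNum n T ≤ ε := by
  classical
  refine entropyNum_le hε
    (S := (latticeBall m K).image fun z => WithLp.toLp q fun i => δ * (z i : ℝ))
    (Finset.card_image_le.trans hcard) fun x hx => ?_
  obtain ⟨z, hz, hzδ, hzx⟩ := exists_int_vector_round (fun i => x i) hδ
  obtain ⟨hzK, hzε⟩ := hround (fun i => x i) z hx hz hzδ hzx
  refine ⟨_, Finset.mem_image_of_mem _ (mem_latticeBall.2 hzK), ?_⟩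
  have heq : T x - WithLp.toLp q (fun i => δ * (z i : ℝ)) =
      WithLp.toLp q fun i => x i - δ * z i := by
    ext i
    simp [hT]
  rwa [heq]

theorem entropyNum_le_rpow (hpq : p < q) (hT : ∀ x i, T x i = x i) {κ : ℝ} (hκ : 0 < κ)
    (hcard : (latticeBall m κ).card ≤ 2 ^ (n - 1)) :
    entropyNum n T ≤ κ ^ (-(1 / p.toReal - 1 / q.toReal)) := by
  have hp1 := one_le_toReal_of_lt hpq
  have hp0 : 0 < p.toReal := by linarith
  refine entropyNum_le_of_lattice hT (δ := κ ^ (-(1 / p.toReal))) (by positivity) (by positivity)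
    hcard fun x z hx hz hzδ hzx =>
      ⟨?_, PiLp.norm_le_of_abs_le_of_norm_le_one hpq hx hκ hzx hzδ⟩
  have hsum := PiLp.sum_rpow_le_of_norm_le hp0 hx
  rw [Real.one_rpow] at hsum
  calc ∑ i, |(z i : ℝ)| ≤ ∑ i, |(z i : ℝ)| ^ p.toReal :=
        Finset.sum_le_sum fun i _ => Int.abs_le_abs_rpow _ hp1
    _ ≤ ∑ i, (|x i| / κ ^ (-(1 / p.toReal))) ^ p.toReal := by
        gcongr with i
        exact hz i
    _ = κ * ∑ i, |x i| ^ p.toReal := by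
        rw [Finset.mul_sum]
        congr 1 with i
        rw [Real.div_rpow (abs_nonneg _) (by positivity), ← Real.rpow_mul hκ.le]
        have h : -(1 / p.toReal) * p.toReal = -1 := by
          field_simp
        rw [h, Real.rpow_neg_one, div_inv_eq_mul, mul_comm]
    _ ≤ κ * 1 := by gcongr
    _ = κ := mul_one κ

theorem entropyNum_le_of_large (hpq : p < q) (hT : ∀ x i, T x i = x i) (hm : 1 ≤ m) {t : ℝ}
    (ht : 0 < t) (hcard : (latticeBall m (m * t)).card ≤ 2 ^ (n - 1)) :
    entropyNum n T ≤ t⁻¹ * (m : ℝ) ^ (1 / q.toReal - 1 / p.toReal) := by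
  have hp1 := one_le_toReal_of_lt hpq
  have hp0 : 0 < p.toReal := by linarith
  have hm0 : (0 : ℝ) < m := by exact_mod_cast hm
  set δ : ℝ := t⁻¹ * (m : ℝ) ^ (-(1 / p.toReal)) with hδ
  have hδ0 : 0 < δ := by positivity
  have hε : t⁻¹ * (m : ℝ) ^ (1 / q.toReal - 1 / p.toReal) = (m : ℝ) ^ (1 / q.toReal) * δ := by
    rw [hδ, sub_eq_add_neg, Real.rpow_add hm0]
    ring
  rw [hε]
  refine entropyNum_le_of_lattice hT hδ0 (by positivity) hcard fun x z hx hz hzδ _ =>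
      ⟨?_, PiLp.norm_le_of_abs_le hδ0.le hzδ⟩
  have hsum := PiLp.sum_rpow_le_of_norm_le hp0 hx
  rw [Real.one_rpow] at hsum
  have hholder : ∑ i, |x i| ≤ (m : ℝ) ^ (1 - 1 / p.toReal) := by
    have h := Real.rpow_sum_le_const_mul_sum_rpow Finset.univ x hp1
    rw [Finset.card_univ, Fintype.card_fin] at h
    have h' : (∑ i, |x i|) ^ p.toReal ≤ (m : ℝ) ^ (p.toReal - 1) :=
      h.trans (mul_le_of_le_one_right (by positivity) hsum)
    refine (Real.rpow_le_rpow_iff (by positivity) (by positivity) hp0).1 (h'.trans_eq ?_)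
    rw [← Real.rpow_mul hm0.le]
    congr 1
    field_simp
  calc ∑ i, |(z i : ℝ)| ≤ ∑ i, |x i| / δ := Finset.sum_le_sum fun i _ => hz i
    _ = (∑ i, |x i|) / δ := by rw [Finset.sum_div]
    _ ≤ (m : ℝ) ^ (1 - 1 / p.toReal) / δ := by gcongr
    _ = m * t := by
        rw [hδ, sub_eq_add_neg, Real.rpow_add hm0, Real.rpow_one]
        field_simp

/-- Packing by a lattice: a large set of lattice points in `B_p` bounds the entropy numbers
from below. -/
theorem le_entropyNum_of_lattice (hT : ∀ x i, T x i = x i) {δ K : ℝ} (hδ : 0 < δ) (hK : 0 ≤ K)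
    {G : Finset (Fin m → ℤ)} (hG : ∀ z ∈ G, ‖WithLp.toLp p fun i => δ * (z i : ℝ)‖ ≤ 1)
    (hcard : 2 ^ (n - 1) * (latticeBall m (K / 4)).card < G.card) :
    δ * K ^ (1 / q.toReal) / 8 ≤ entropyNum n T := by
  classical
  refine le_entropyNum fun ε S _ hS hcover => ?_
  by_contra! hlt
  have hcenter : ∀ z : Fin m → ℤ, ∃ y, z ∈ G →
      y ∈ S ∧ ‖WithLp.toLp q (fun i => δ * (z i : ℝ)) - y‖ ≤ ε := by
    intro z
    by_cases hz : z ∈ G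
    · obtain ⟨y, hy, hzy⟩ := hcover _ (hG z hz)
      refine ⟨y, fun _ => ⟨hy, ?_⟩⟩
      have heq : T (WithLp.toLp p fun i => δ * (z i : ℝ)) =
          WithLp.toLp q fun i => δ * (z i : ℝ) := by
        ext i
        simp [hT]
      rwa [heq] at hzy
    · exact ⟨0, fun h => absurd h hz⟩
  choose f hf using hcenter
  have hbound : G.card ≤ (latticeBall m (K / 4)).card * S.card := by
    refine Finset.card_le_mul_card_image_of_maps_to (f := f) (fun z hz => (hf z hz).1) _
      fun y _ => ?_
    rcases Finset.eq_empty_or_nonempty {z ∈ G | f z = y} with hempty | ⟨w, hw⟩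
    · simp [hempty]
    · rw [Finset.mem_filter] at hw
      refine Finset.card_le_card_of_injOn (fun z => z - w) ?_
        fun _ _ _ _ h => sub_left_injective h
      intro z hz
      have hz' := Finset.mem_filter.1 hz
      refine mem_latticeBall.2 (sum_abs_le_of_norm_le (q := q) hK ?_)
      have hdiff : ‖WithLp.toLp q (fun i => δ * (z i : ℝ)) -
          WithLp.toLp q (fun i => δ * (w i : ℝ))‖ ≤ ε + ε := by
        have h1 := (hf z hz'.1).2
        have h2 := (hf w hw.1).2
        rw [hz'.2] at h1
        rw [hw.2, norm_sub_rev] at h2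
        calc _ = ‖(WithLp.toLp q (fun i => δ * (z i : ℝ)) - y) +
              (y - WithLp.toLp q (fun i => δ * (w i : ℝ)))‖ := by
              congr 1
              abel
          _ ≤ _ := (norm_add_le _ _).trans (add_le_add h1 h2)
      have hscale : WithLp.toLp q (fun i => δ * (z i : ℝ)) -
          WithLp.toLp q (fun i => δ * (w i : ℝ)) =
            δ • WithLp.toLp q (fun i => (((z - w) i : ℤ) : ℝ)) := by
        ext i
        simp [mul_sub]
      rw [hscale, norm_smul, Real.norm_of_nonneg hδ.le] at hdiff
      have hlt' : δ * ‖WithLp.toLp q fun i => (((z - w) i : ℤ) : ℝ)‖ ≤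
          δ * (K ^ (1 / q.toReal) / 4) := by linarith
      exact le_of_mul_le_mul_left hlt' hδ
  have := Nat.mul_le_mul_left (latticeBall m (K / 4)).card hS
  rw [mul_comm] at hcard
  omega

theorem le_entropyNum_of_choose (hpq : p < q) (hT : ∀ x i, T x i = x i) {k : ℕ} (hk : 1 ≤ k)
    (hcard : 2 ^ (n - 1) * (latticeBall m (k / 4)).card < m.choose k) :
    (k : ℝ) ^ (-(1 / p.toReal - 1 / q.toReal)) / 8 ≤ entropyNum n T := by
  classical
  have hp1 := one_le_toReal_of_lt hpq
  have hp0 : 0 < p.toReal := by linarith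
  have hk0 : (0 : ℝ) < k := by exact_mod_cast hk
  have hrw : (k : ℝ) ^ (-(1 / p.toReal - 1 / q.toReal)) =
      (k : ℝ) ^ (-(1 / p.toReal)) * (k : ℝ) ^ (1 / q.toReal) := by
    rw [← Real.rpow_add hk0]
    congr 1
    ring
  rw [hrw]
  let ind : Finset (Fin m) → Fin m → ℤ := fun s i => if i ∈ s then 1 else 0
  have hind : Function.Injective ind := by
    intro s t hst
    ext i
    have hi := congrFun hst i
    by_cases hs : i ∈ s <;> by_cases ht : i ∈ t <;> simp_all [ind]
  refine le_entropyNum_of_lattice hT (G := (Finset.powersetCard k Finset.univ).image ind)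
    (by positivity) hk0.le ?_ ?_
  · intro z hz
    obtain ⟨s, hs, rfl⟩ := Finset.mem_image.1 hz
    have hs' := (Finset.mem_powersetCard.1 hs).2
    apply PiLp.norm_le_of_sum_rpow_le hp0 zero_le_one
    have hterm : ∀ i, |(k : ℝ) ^ (-(1 / p.toReal)) * (ind s i : ℝ)| ^ p.toReal =
        if i ∈ s then (k : ℝ)⁻¹ else 0 := by
      intro i
      by_cases hi : i ∈ s
      · simp only [ind, hi, if_true, Int.cast_one, mul_one]
        rw [abs_of_pos (by positivity), ← Real.rpow_mul hk0.le]
        have h : -(1 / p.toReal) * p.toReal = -1 := by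
          field_simp
        rw [h, Real.rpow_neg_one]
      · simp [ind, hi, hp0.ne']
    simp only [hterm]
    rw [Finset.sum_ite_mem, Finset.univ_inter, Finset.sum_const, hs', Real.one_rpow, nsmul_eq_mul,
      mul_inv_cancel₀ hk0.ne']
  · rwa [Finset.card_image_of_injective _ hind, Finset.card_powersetCard, Finset.card_univ,
      Fintype.card_fin]

theorem le_entropyNum_of_volume (hpq : p < q) (hT : ∀ x i, T x i = x i) (hm : 1 ≤ m) :
    (2 : ℝ) ^ (-(n : ℝ) / m) * (m : ℝ) ^ (1 / q.toReal - 1 / p.toReal) / 48 ≤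
      entropyNum n T := by
  have hp1 := one_le_toReal_of_lt hpq
  have hp0 : 0 < p.toReal := by linarith
  have hm0 : (0 : ℝ) < m := by exact_mod_cast hm
  set a : ℝ := (2 : ℝ) ^ ((n : ℝ) / m) with ha
  have ha0 : 0 < a := by positivity
  have ham : a ^ m = 2 ^ n := by
    rw [ha, ← Real.rpow_natCast, ← Real.rpow_mul (by norm_num), div_mul_cancel₀ _ hm0.ne',
      Real.rpow_natCast]
  set δ : ℝ := (m : ℝ) ^ (-(1 / p.toReal)) / (6 * a) with hδ
  have hδ0 : 0 < δ := by positivity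
  have hrw : (2 : ℝ) ^ (-(n : ℝ) / m) * (m : ℝ) ^ (1 / q.toReal - 1 / p.toReal) / 48 =
      δ * (m : ℝ) ^ (1 / q.toReal) / 8 := by
    rw [hδ, neg_div, Real.rpow_neg (by norm_num), ← ha, sub_eq_add_neg, Real.rpow_add hm0]
    field_simp
    norm_num
  rw [hrw]
  set M : ℕ := ⌊6 * a⌋₊ with hM
  refine le_entropyNum_of_lattice hT hδ0 hm0.le
    (G := Fintype.piFinset fun _ => Finset.Icc 0 (M : ℤ)) ?_ ?_
  · intro z hz
    rw [Fintype.mem_piFinset] at hz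
    apply PiLp.norm_le_of_sum_rpow_le hp0 zero_le_one
    have hterm : ∀ i, |δ * (z i : ℝ)| ≤ (m : ℝ) ^ (-(1 / p.toReal)) := by
      intro i
      obtain ⟨h1, h2⟩ := Finset.mem_Icc.1 (hz i)
      have h1' : (0 : ℝ) ≤ z i := by exact_mod_cast h1
      have h2' : (z i : ℝ) ≤ 6 * a :=
        le_trans (by exact_mod_cast h2) (Nat.floor_le (by positivity))
      rw [abs_of_nonneg (by positivity), hδ, div_mul_eq_mul_div, div_le_iff₀ (by positivity)]
      gcongr
    calc ∑ i, |δ * (z i : ℝ)| ^ p.toReal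
        ≤ ∑ _i : Fin m, ((m : ℝ) ^ (-(1 / p.toReal))) ^ p.toReal := by
          gcongr with i
          exact hterm i
      _ = 1 ^ p.toReal := by
          have h : -(1 / p.toReal) * p.toReal = -1 := by
            field_simp
          rw [← Real.rpow_mul hm0.le, h, Real.rpow_neg_one, Finset.sum_const, Finset.card_univ,
            Fintype.card_fin, nsmul_eq_mul, mul_inv_cancel₀ hm0.ne', Real.one_rpow]
  · have hcardG : (Fintype.piFinset fun _ : Fin m => Finset.Icc 0 (M : ℤ)).card = (M + 1) ^ m := by
      simp [Fintype.card_piFinset]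
    rw [hcardG]
    have hreal : (2 : ℝ) ^ (n - 1) * (latticeBall m (m / 4)).card < ((M : ℝ) + 1) ^ m := by
      calc (2 : ℝ) ^ (n - 1) * (latticeBall m (m / 4)).card ≤ 2 ^ n * 6 ^ m := by
            gcongr
            · norm_num
            · omega
            · exact card_latticeBall_quarter_le m
        _ = (6 * a) ^ m := by rw [mul_pow, ham, mul_comm]
        _ < ((M : ℝ) + 1) ^ m :=
            pow_lt_pow_left₀ (Nat.lt_floor_add_one _) (by positivity) (by omega)
    exact_mod_cast hreal

end Identity

theorem card_latticeBall_le_one {m : ℕ} {K : ℝ} (hK : K < 1) : (latticeBall m K).card ≤ 1 := by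
  have hzero : ∀ z ∈ latticeBall m K, z = 0 := by
    intro z hz
    ext i
    have hi : |(z i : ℝ)| ≤ K :=
      (Finset.single_le_sum (f := fun i => |(z i : ℝ)|) (fun _ _ => abs_nonneg _)
        (Finset.mem_univ i)).trans (mem_latticeBall.1 hz)
    have hi' : |z i| < 1 := by exact_mod_cast hi.trans_lt hK
    simpa [Int.abs_lt_one_iff] using hi'
  exact Finset.card_le_one.2 fun z hz w hw => (hzero z hz).trans (hzero w hw).symm

theorem one_le_logb_div_add_one {m n : ℕ} (hn : 1 ≤ n) (hnm : n ≤ m) :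
    1 ≤ Real.logb 2 ((m : ℝ) / n + 1) := by
  have hn0 : (0 : ℝ) < n := by exact_mod_cast hn
  have h : 1 ≤ (m : ℝ) / n := by
    rw [one_le_div hn0]
    exact_mod_cast hnm
  rw [Real.le_logb_iff_rpow_le (by norm_num) (by linarith), Real.rpow_one]
  linarith

theorem card_latticeBall_le_two_pow {m n : ℕ} (hn : 1 ≤ n) (hnm : n ≤ m) :
    (latticeBall m (n / (16 * Real.logb 2 ((m : ℝ) / n + 1)))).card ≤ 2 ^ (n - 1) := by
  set L : ℝ := Real.logb 2 ((m : ℝ) / n + 1) with hL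
  have hL1 : 1 ≤ L := one_le_logb_div_add_one hn hnm
  have hn0 : (0 : ℝ) < n := by exact_mod_cast hn
  have hnm' : (n : ℝ) ≤ m := by exact_mod_cast hnm
  have hm0 : (0 : ℝ) < m := hn0.trans_le hnm'
  set κ : ℝ := n / (16 * L) with hκ
  have hκ0 : 0 < κ := by positivity
  rcases lt_or_ge κ 1 with hκ1 | hκ1
  · exact (card_latticeBall_le_one hκ1).trans Nat.one_le_two_pow
  · have hκn : κ * (16 * L) = n := by
      rw [hκ]
      field_simp
    have hn16 : (16 : ℝ) ≤ n := by nlinarith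
    have hκm : κ ≤ m := by nlinarith
    have hpowL : (2 : ℝ) ^ L = (m : ℝ) / n + 1 :=
      Real.rpow_logb (by norm_num) (by norm_num) (by positivity)
    have hLle : L ≤ (2 : ℝ) ^ L := by
      have h1 := one_add_mul_self_le_rpow_one_add (s := 1) (by norm_num) hL1
      norm_num at h1
      linarith
    have hbase : 16 * m / κ ≤ (2 : ℝ) ^ (10 * L) := by
      calc 16 * m / κ = 256 * ((m : ℝ) / n) * L := by
            rw [hκ]
            field_simp
            norm_num
        _ ≤ (2 : ℝ) ^ (8 * L) * 2 ^ L * 2 ^ L := by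
            gcongr
            · calc (256 : ℝ) = (2 : ℝ) ^ (8 : ℝ) := by norm_num
                _ ≤ 2 ^ (8 * L) := Real.rpow_le_rpow_of_exponent_le (by norm_num) (by linarith)
            · linarith
        _ = (2 : ℝ) ^ (10 * L) := by
            rw [← Real.rpow_add (by norm_num), ← Real.rpow_add (by norm_num)]
            congr 1
            ring
    have hreal : ((latticeBall m κ).card : ℝ) ≤ (2 : ℝ) ^ (n - 1) := by
      calc ((latticeBall m κ).card : ℝ) ≤ (16 * m / κ) ^ κ := card_latticeBall_le_of_le hκ0 hκm
        _ ≤ ((2 : ℝ) ^ (10 * L)) ^ κ := by gcongr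
        _ = (2 : ℝ) ^ (10 * L * κ) := by rw [← Real.rpow_mul (by norm_num)]
        _ ≤ (2 : ℝ) ^ ((n - 1 : ℕ) : ℝ) := by
            apply Real.rpow_le_rpow_of_exponent_le (by norm_num)
            push_cast [hn]
            linarith
        _ = (2 : ℝ) ^ (n - 1) := Real.rpow_natCast _ _
    exact_mod_cast hreal

theorem div_two_pow_le_choose {m k : ℕ} (hk : 1 ≤ k) (hkm : 2 * k ≤ m) :
    ((m : ℝ) / k / 2) ^ k ≤ m.choose k := by
  have hk0 : (0 : ℝ) < k := by exact_mod_cast hk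
  have hkm' : 2 * (k : ℝ) ≤ m := by exact_mod_cast hkm
  calc ((m : ℝ) / k / 2) ^ k = ((m : ℝ) / 2) ^ k / (k : ℝ) ^ k := by
        rw [← div_pow]
        congr 1
        ring
    _ ≤ ((m + 1 - k : ℕ) : ℝ) ^ k / (k.factorial : ℝ) := by
        gcongr
        · rw [Nat.cast_sub (by omega)]
          push_cast
          linarith
        · exact_mod_cast Nat.factorial_le_pow k
    _ ≤ m.choose k := Nat.pow_le_choose k m

/-- Sparse `0-1` vectors outnumber the product of `2 ^ (n - 1)` and the number of lattice points
in a small `ℓ_1`-ball. -/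
theorem two_pow_mul_card_lt_choose {m n k : ℕ} (hn : 1 ≤ n) (hk : 1 ≤ k) (hkm : 128 * k ≤ m)
    {L : ℝ} (hkL : 8 * (n : ℝ) ≤ k * L) (hmk : (2 : ℝ) ^ (L / 3) ≤ (m : ℝ) / k) :
    2 ^ (n - 1) * (latticeBall m (k / 4)).card < m.choose k := by
  have hk0 : (0 : ℝ) < k := by exact_mod_cast hk
  have hkm' : 128 * (k : ℝ) ≤ m := by exact_mod_cast hkm
  set R : ℝ := (m : ℝ) / k with hR
  have hR128 : 128 ≤ R := by rwa [hR, le_div_iff₀ hk0]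
  have hR0 : 0 < R := by linarith
  have hcard : ((latticeBall m (k / 4)).card : ℝ) ≤ (64 * R) ^ ((k : ℝ) / 4) := by
    have h := card_latticeBall_le_of_le (m := m) (K := (k : ℝ) / 4) (by positivity) (by linarith)
    convert h using 2
    rw [hR]
    field_simp
    ring
  have hn2 : (2 : ℝ) ^ n ≤ (R ^ (3 / 2 : ℝ)) ^ ((k : ℝ) / 4) := by
    calc (2 : ℝ) ^ n = (2 : ℝ) ^ (n : ℝ) := (Real.rpow_natCast _ _).symm
      _ ≤ (2 : ℝ) ^ (L / 3 * (3 / 2 * (k / 4))) := by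
          apply Real.rpow_le_rpow_of_exponent_le (by norm_num)
          linarith
      _ = ((2 : ℝ) ^ (L / 3)) ^ (3 / 2 * ((k : ℝ) / 4)) := by rw [← Real.rpow_mul (by norm_num)]
      _ ≤ R ^ (3 / 2 * ((k : ℝ) / 4)) := by gcongr
      _ = (R ^ (3 / 2 : ℝ)) ^ ((k : ℝ) / 4) := by rw [← Real.rpow_mul hR0.le]
  have hR32 : R ^ (3 / 2 : ℝ) * (64 * R) ≤ (R / 2) ^ (4 : ℝ) := by
    have h1 : (1024 : ℝ) ≤ R ^ (3 / 2 : ℝ) := by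
      calc (1024 : ℝ) ≤ ((2 : ℝ) ^ (7 : ℝ)) ^ (3 / 2 : ℝ) := by
            rw [← Real.rpow_mul (by norm_num)]
            calc (1024 : ℝ) = (2 : ℝ) ^ (10 : ℝ) := by norm_num
              _ ≤ _ := Real.rpow_le_rpow_of_exponent_le (by norm_num) (by norm_num)
        _ ≤ R ^ (3 / 2 : ℝ) := by
            gcongr
            norm_num
            exact hR128
    have h2 : R ^ (3 / 2 : ℝ) * R ^ (3 / 2 : ℝ) = R ^ 3 := by
      rw [← Real.rpow_add hR0, ← Real.rpow_natCast]
      norm_num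
    have h3 : (R / 2) ^ (4 : ℝ) = R ^ 3 * R / 16 := by
      rw [show (4 : ℝ) = ((4 : ℕ) : ℝ) by norm_num, Real.rpow_natCast]
      ring
    rw [h3, ← h2]
    have h4 : 0 ≤ R ^ (3 / 2 : ℝ) * R := by positivity
    nlinarith
  have hreal : (2 : ℝ) ^ (n - 1) * (latticeBall m (k / 4)).card < m.choose k := by
    have hpos : (0 : ℝ) < (64 * R) ^ ((k : ℝ) / 4) := by positivity
    calc (2 : ℝ) ^ (n - 1) * (latticeBall m (k / 4)).card
        ≤ (2 : ℝ) ^ (n - 1) * (64 * R) ^ ((k : ℝ) / 4) := by gcongr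
      _ < (2 : ℝ) ^ n * (64 * R) ^ ((k : ℝ) / 4) := by
          have : (2 : ℝ) ^ (n - 1) < 2 ^ n := pow_lt_pow_right₀ (by norm_num) (by omega)
          gcongr
      _ ≤ (R ^ (3 / 2 : ℝ)) ^ ((k : ℝ) / 4) * (64 * R) ^ ((k : ℝ) / 4) := by gcongr
      _ = (R ^ (3 / 2 : ℝ) * (64 * R)) ^ ((k : ℝ) / 4) := by
          rw [Real.mul_rpow (x := R ^ (3 / 2 : ℝ)) (by positivity) (by positivity)]
      _ ≤ ((R / 2) ^ (4 : ℝ)) ^ ((k : ℝ) / 4) := by gcongr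
      _ = (R / 2) ^ k := by
          rw [← Real.rpow_mul (by positivity), ← Real.rpow_natCast]
          congr 1
          ring
      _ ≤ m.choose k := div_two_pow_le_choose hk (by omega)
  exact_mod_cast hreal

theorem exists_sparsity {m n : ℕ} (hn : 1 ≤ n) (hmn : 256 * n ≤ m)
    (hlog : Real.logb 2 m ≤ n) :
    ∃ k : ℕ, 1 ≤ k ∧ (k : ℝ) ≤ 10 * (n / Real.logb 2 ((m : ℝ) / n + 1)) ∧
      2 ^ (n - 1) * (latticeBall m (k / 4)).card < m.choose k := by
  have hn0 : (0 : ℝ) < n := by exact_mod_cast hn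
  have hn1 : (1 : ℝ) ≤ n := by exact_mod_cast hn
  have hmn' : 256 * (n : ℝ) ≤ m := by exact_mod_cast hmn
  have hm0 : (0 : ℝ) < m := by linarith
  set y : ℝ := (m : ℝ) / n with hy
  have hy256 : 256 ≤ y := by rwa [hy, le_div_iff₀ hn0]
  have hyn : y * n = m := by
    rw [hy]
    field_simp
  set L : ℝ := Real.logb 2 (y + 1) with hL
  have hL8 : 8 ≤ L := by
    rw [hL, Real.le_logb_iff_rpow_le (by norm_num) (by linarith)]
    norm_num
    linarith
  have hL0 : 0 < L := by linarith
  have hpowL : (2 : ℝ) ^ L = y + 1 :=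
    Real.rpow_logb (by norm_num) (by norm_num) (by linarith)
  have hL2n : L ≤ 2 * n := by
    have h1 : L ≤ Real.logb 2 (m * 2) := by
      apply Real.logb_le_logb_of_le (by norm_num) (by linarith)
      nlinarith
    rw [Real.logb_mul hm0.ne' (by norm_num), Real.logb_self_eq_one (by norm_num)] at h1
    linarith
  have hnL : 1 / 2 ≤ n / L := by
    rw [div_le_div_iff₀ (by norm_num) hL0]
    linarith
  set k : ℕ := ⌈8 * (n / L)⌉₊ with hk
  have hk1 : 8 * (n / L) ≤ k := Nat.le_ceil _
  have hk2 : (k : ℝ) ≤ 10 * (n / L) := by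
    have := Nat.ceil_lt_add_one (a := 8 * (n / L)) (by positivity)
    linarith
  have hkpos : 1 ≤ k := by
    have : (0 : ℝ) < k := by linarith
    exact_mod_cast this
  have hk0 : (0 : ℝ) < k := by exact_mod_cast hkpos
  have hkL : k * L ≤ 10 * n := by
    calc k * L ≤ 10 * (n / L) * L := by gcongr
      _ = 10 * n := by field_simp
  refine ⟨k, hkpos, hk2, two_pow_mul_card_lt_choose hn hkpos ?_ (L := L) ?_ ?_⟩
  · have : 128 * (k : ℝ) ≤ m := by nlinarith
    exact_mod_cast this
  · calc 8 * (n : ℝ) = 8 * (n / L) * L := by field_simp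
      _ ≤ k * L := by gcongr
  · have hyk : y / 2 ≤ (m : ℝ) / k := by
      rw [div_le_div_iff₀ (by norm_num) hk0, ← hyn]
      have : (k : ℝ) ≤ 2 * n := by nlinarith
      nlinarith
    refine le_trans ?_ hyk
    have hcube : ((2 : ℝ) ^ (L / 3)) ^ 3 = y + 1 := by
      rw [← Real.rpow_natCast, ← Real.rpow_mul (by norm_num), ← hpowL]
      congr 1
      push_cast
      ring
    refine le_of_pow_le_pow_left₀ (n := 3) (by norm_num) (by linarith) ?_
    rw [hcube]
    nlinarith [mul_nonneg (sub_nonneg.2 hy256) (sub_nonneg.2 hy256),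
      mul_nonneg (sub_nonneg.2 hy256) (sq_nonneg y)]

theorem Real.rpow_le_self_of_exponent_le_one {a s : ℝ} (ha : 1 ≤ a) (hs : s ≤ 1) : a ^ s ≤ a := by
  simpa using Real.rpow_le_rpow_of_exponent_le ha hs

section Identity

variable {p q : ℝ≥0∞} [hp : Fact (1 ≤ p)] [hq : Fact (1 ≤ q)] {m n : ℕ}
  {T : PiLp p (fun _ : Fin m => ℝ) →L[ℝ] PiLp q (fun _ : Fin m => ℝ)}

theorem exponent_mem_Icc (hpq : p < q) :
    0 ≤ 1 / p.toReal - 1 / q.toReal ∧ 1 / p.toReal - 1 / q.toReal ≤ 1 := by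
  have hp1 := one_le_toReal_of_lt hpq
  have hq0 : 0 ≤ 1 / q.toReal := by positivity
  have hp' : 1 / p.toReal ≤ 1 := by
    rw [div_le_one (by linarith)]
    exact hp1
  refine ⟨?_, by linarith⟩
  rcases eq_or_ne q ∞ with rfl | hq'
  · simp
  · have := one_div_le_one_div_of_le (by linarith) (ENNReal.toReal_mono hq' hpq.le)
    linarith

theorem entropyNum_le_two (hpq : p < q) (hT : ∀ x i, T x i = x i) : entropyNum n T ≤ 2 := by
  have h := entropyNum_le_rpow (n := n) hpq hT (κ := 1 / 2) (by norm_num)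
    ((card_latticeBall_le_one (by norm_num)).trans Nat.one_le_two_pow)
  rw [Real.rpow_neg (by norm_num), ← Real.inv_rpow (by norm_num)] at h
  refine (h.trans (Real.rpow_le_self_of_exponent_le_one (by norm_num)
    (exponent_mem_Icc hpq).2)).trans ?_
  norm_num

theorem entropyNum_le_of_le (hpq : p < q) (hT : ∀ x i, T x i = x i) (hn : 1 ≤ n) (hnm : n ≤ m) :
    entropyNum n T ≤
      16 * (Real.logb 2 ((m : ℝ) / n + 1) / n) ^ (1 / p.toReal - 1 / q.toReal) := by
  have h := card_latticeBall_le_two_pow hn hnm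
  have hL1 := one_le_logb_div_add_one hn hnm
  set L : ℝ := Real.logb 2 ((m : ℝ) / n + 1)
  have hn0 : (0 : ℝ) < n := by exact_mod_cast hn
  have hs := (exponent_mem_Icc hpq).2
  have hle := entropyNum_le_rpow hpq hT (by positivity) h
  set s : ℝ := 1 / p.toReal - 1 / q.toReal
  calc entropyNum n T ≤ (n / (16 * L)) ^ (-s) := hle
    _ = 16 ^ s * (L / n) ^ s := by
        rw [Real.rpow_neg (by positivity), ← Real.inv_rpow (by positivity),
          ← Real.mul_rpow (by positivity) (by positivity)]
        congr 1
        field_simp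
    _ ≤ 16 * (L / n) ^ s := by
        gcongr
        exact Real.rpow_le_self_of_exponent_le_one (by norm_num) hs

theorem entropyNum_le_of_ge (hpq : p < q) (hT : ∀ x i, T x i = x i) (hm : 1 ≤ m) (hmn : m ≤ n) :
    entropyNum n T ≤
      512 * ((2 : ℝ) ^ (-(n : ℝ) / m) * (m : ℝ) ^ (1 / q.toReal - 1 / p.toReal)) := by
  have hm0 : (0 : ℝ) < m := by exact_mod_cast hm
  set a : ℝ := (2 : ℝ) ^ ((n : ℝ) / m) with ha
  have ha0 : 0 < a := by positivity
  have hneg : (2 : ℝ) ^ (-(n : ℝ) / m) = a⁻¹ := by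
    rw [ha, neg_div, Real.rpow_neg (by norm_num)]
  rw [hneg]
  rcases lt_or_ge n (5 * m) with hlt | hge
  · have ha32 : a ≤ 32 := by
      calc a ≤ (2 : ℝ) ^ (5 : ℝ) := by
            apply Real.rpow_le_rpow_of_exponent_le (by norm_num)
            rw [div_le_iff₀ hm0]
            exact_mod_cast hlt.le
        _ = 32 := by norm_num
    have hle := (entropyNum_antitone T hmn).trans (entropyNum_le_of_le hpq hT hm le_rfl)
    have hlog : Real.logb 2 ((m : ℝ) / m + 1) = 1 := by
      rw [div_self hm0.ne', one_add_one_eq_two, Real.logb_self_eq_one (by norm_num)]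
    have hinv : (1 / (m : ℝ)) ^ (1 / p.toReal - 1 / q.toReal) =
        (m : ℝ) ^ (1 / q.toReal - 1 / p.toReal) := by
      rw [one_div, Real.inv_rpow hm0.le, ← Real.rpow_neg hm0.le, neg_sub]
    rw [hlog, hinv] at hle
    have h16 : (16 : ℝ) ≤ 512 * a⁻¹ := by
      rw [← div_eq_mul_inv, le_div_iff₀ ha0]
      linarith
    calc entropyNum n T ≤ 16 * (m : ℝ) ^ (1 / q.toReal - 1 / p.toReal) := hle
      _ ≤ 512 * a⁻¹ * (m : ℝ) ^ (1 / q.toReal - 1 / p.toReal) := by gcongr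
      _ = _ := by ring
  · have ha32 : 32 ≤ a := by
      calc (32 : ℝ) = (2 : ℝ) ^ (5 : ℝ) := by norm_num
        _ ≤ a := by
            apply Real.rpow_le_rpow_of_exponent_le (by norm_num)
            rw [le_div_iff₀ hm0]
            exact_mod_cast hge
    have ham : a ^ m = 2 ^ n := by
      rw [ha, ← Real.rpow_natCast, ← Real.rpow_mul (by norm_num), div_mul_cancel₀ _ hm0.ne',
        Real.rpow_natCast]
    have hcard : (latticeBall m (m * (a / 24))).card ≤ 2 ^ (n - 1) := by
      have hreal : ((latticeBall m (m * (a / 24))).card : ℝ) ≤ (2 : ℝ) ^ (n - 1) := by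
        calc ((latticeBall m (m * (a / 24))).card : ℝ) ≤ (12 * (a / 24)) ^ m :=
              card_latticeBall_mul_le (by linarith)
          _ = 2 ^ n / 2 ^ m := by
              rw [← ham, ← div_pow]
              congr 1
              ring
          _ ≤ 2 ^ n / 2 ^ 1 := by
              gcongr
              norm_num
          _ = 2 ^ (n - 1) := by rw [div_eq_mul_inv, ← pow_sub₀ _ (by norm_num) (by omega)]
      exact_mod_cast hreal
    calc entropyNum n T ≤ (a / 24)⁻¹ * (m : ℝ) ^ (1 / q.toReal - 1 / p.toReal) :=
          entropyNum_le_of_large hpq hT hm (by positivity) hcard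
      _ = 24 * (a⁻¹ * (m : ℝ) ^ (1 / q.toReal - 1 / p.toReal)) := by
          rw [inv_div]
          ring
      _ ≤ _ := by
          gcongr
          norm_num

theorem le_entropyNum_of_le_logb (hpq : p < q) (hT : ∀ x i, T x i = x i) (hm : 1 ≤ m)
    (hn : 1 ≤ n) (hlog : (n : ℝ) ≤ Real.logb 2 m) : 1 / 8 ≤ entropyNum n T := by
  have hm0 : (0 : ℝ) < m := by exact_mod_cast hm
  rw [Real.le_logb_iff_rpow_le (by norm_num) hm0, Real.rpow_natCast] at hlog
  have hpow : 2 ^ n ≤ m := by exact_mod_cast hlog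
  have hcard : (latticeBall m (((1 : ℕ) : ℝ) / 4)).card ≤ 1 :=
    card_latticeBall_le_one (by norm_num)
  have h := le_entropyNum_of_choose (n := n) hpq hT le_rfl (by
    rw [Nat.choose_one_right]
    calc 2 ^ (n - 1) * (latticeBall m (((1 : ℕ) : ℝ) / 4)).card ≤ 2 ^ (n - 1) * 1 := by gcongr
      _ < 2 ^ n := by
          rw [mul_one]
          exact Nat.pow_lt_pow_right (by norm_num) (by omega)
      _ ≤ m := hpow)
  simpa using h

theorem le_entropyNum_of_le (hpq : p < q) (hT : ∀ x i, T x i = x i) (hn : 1 ≤ n)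
    (hlog : Real.logb 2 m ≤ n) (hnm : n ≤ m) :
    1 / 221184 * (Real.logb 2 ((m : ℝ) / n + 1) / n) ^ (1 / p.toReal - 1 / q.toReal) ≤
      entropyNum n T := by
  have hn0 : (0 : ℝ) < n := by exact_mod_cast hn
  have hnm' : (n : ℝ) ≤ m := by exact_mod_cast hnm
  have hm0 : (0 : ℝ) < m := by linarith
  obtain ⟨hs0, hs1⟩ := exponent_mem_Icc hpq
  have hL1 := one_le_logb_div_add_one hn hnm
  rcases le_or_gt (256 * n) m with hsmall | hlarge
  · obtain ⟨k, hk, hkle, hcard⟩ := exists_sparsity hn hsmall hlog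
    have hk0 : (0 : ℝ) < k := by exact_mod_cast hk
    have h := le_entropyNum_of_choose hpq hT hk hcard
    set L : ℝ := Real.logb 2 ((m : ℝ) / n + 1)
    set s : ℝ := 1 / p.toReal - 1 / q.toReal
    have hkey : (L / n) ^ s ≤ 10 * (k : ℝ) ^ (-s) := by
      calc (L / n) ^ s ≤ (10 * (k : ℝ)⁻¹) ^ s := by
            gcongr
            rw [← div_eq_mul_inv, div_le_div_iff₀ hn0 hk0]
            calc L * k ≤ L * (10 * (n / L)) := by gcongr
              _ = 10 * n := by field_simp
        _ = 10 ^ s * (k : ℝ) ^ (-s) := by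
            rw [Real.mul_rpow (by norm_num) (by positivity), Real.inv_rpow hk0.le,
              Real.rpow_neg hk0.le]
        _ ≤ 10 * (k : ℝ) ^ (-s) := by
            gcongr
            exact Real.rpow_le_self_of_exponent_le_one (by norm_num) hs1
    have hpos : 0 < (k : ℝ) ^ (-s) := by positivity
    linarith
  · have hlarge' : (m : ℝ) < 256 * n := by exact_mod_cast hlarge
    have hL9 : Real.logb 2 ((m : ℝ) / n + 1) ≤ 9 := by
      rw [Real.logb_le_iff_le_rpow (by norm_num) (by positivity)]
      have : (m : ℝ) / n ≤ 256 := by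
        rw [div_le_iff₀ hn0]
        exact hlarge'.le
      norm_num
      linarith
    have h := le_entropyNum_of_volume (n := n) hpq hT (hn.trans hnm)
    have hhalf : 1 / 2 ≤ (2 : ℝ) ^ (-(n : ℝ) / m) := by
      calc (1 / 2 : ℝ) = (2 : ℝ) ^ (-1 : ℝ) := by rw [Real.rpow_neg_one]; norm_num
        _ ≤ _ := by
            apply Real.rpow_le_rpow_of_exponent_le (by norm_num)
            rw [le_div_iff₀ hm0]
            linarith
    rw [← neg_sub (1 / p.toReal)] at h
    set L : ℝ := Real.logb 2 ((m : ℝ) / n + 1)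
    set s : ℝ := 1 / p.toReal - 1 / q.toReal
    have hkey : (L / n) ^ s ≤ 2304 * (m : ℝ) ^ (-s) := by
      calc (L / n) ^ s ≤ (2304 * (m : ℝ)⁻¹) ^ s := by
            gcongr
            rw [← div_eq_mul_inv, div_le_div_iff₀ hn0 hm0]
            nlinarith
        _ = 2304 ^ s * (m : ℝ) ^ (-s) := by
            rw [Real.mul_rpow (by norm_num) (by positivity), Real.inv_rpow hm0.le,
              Real.rpow_neg hm0.le]
        _ ≤ 2304 * (m : ℝ) ^ (-s) := by
            gcongr
            exact Real.rpow_le_self_of_exponent_le_one (by norm_num) hs1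
    have hpos : 0 < (m : ℝ) ^ (-s) := by positivity
    nlinarith

end Identity

/-- Schütt's theorem: two-sided estimates for the entropy numbers of the identity
embedding `ℓ_p^m → ℓ_q^m`, `1 ≤ p < q ≤ ∞`. -/
theorem schuett_theorem (p q : ℝ≥0∞) [Fact (1 ≤ p)] [Fact (1 ≤ q)] (hpq : p < q) :
    ∃ c₁ c₂ : ℝ, 0 < c₁ ∧ 0 < c₂ ∧
      ∀ (m n : ℕ), 1 ≤ m → 1 ≤ n →
        ∀ T : PiLp p (fun _ : Fin m => ℝ) →L[ℝ] PiLp q (fun _ : Fin m => ℝ),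
          (∀ x i, T x i = x i) →
          (((n : ℝ) ≤ Real.logb 2 m →
              c₁ * 1 ≤ entropyNum n T ∧ entropyNum n T ≤ c₂ * 1) ∧
           (Real.logb 2 m ≤ (n : ℝ) ∧ n ≤ m →
              c₁ * (Real.logb 2 ((m : ℝ) / n + 1) / n) ^ (1 / p.toReal - 1 / q.toReal)
                  ≤ entropyNum n T ∧
                entropyNum n T
                  ≤ c₂ * (Real.logb 2 ((m : ℝ) / n + 1) / n) ^ (1 / p.toReal - 1 / q.toReal)) ∧
           (m ≤ n →
              c₁ * ((2 : ℝ) ^ (-(n : ℝ) / m) * (m : ℝ) ^ (1 / q.toReal - 1 / p.toReal))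
                  ≤ entropyNum n T ∧
                entropyNum n T
                  ≤ c₂ * ((2 : ℝ) ^ (-(n : ℝ) / m) * (m : ℝ) ^ (1 / q.toReal - 1 / p.toReal)))) := by
  refine ⟨1 / 221184, 512, by norm_num, by norm_num, fun m n hm hn T hT =>
    ⟨fun hlog => ⟨?_, ?_⟩, fun h => ⟨le_entropyNum_of_le hpq hT hn h.1 h.2, ?_⟩,
      fun hmn => ⟨?_, entropyNum_le_of_ge hpq hT hm hmn⟩⟩⟩
  · exact le_trans (by norm_num) (le_entropyNum_of_le_logb hpq hT hm hn hlog)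
  · exact (entropyNum_le_two hpq hT).trans (by norm_num)
  · have hL1 := one_le_logb_div_add_one hn h.2
    refine (entropyNum_le_of_le hpq hT hn h.2).trans ?_
    gcongr
    norm_num
  · refine le_trans ?_ (le_entropyNum_of_volume hpq hT hm)
    have hpos : 0 ≤ (2 : ℝ) ^ (-(n : ℝ) / m) * (m : ℝ) ^ (1 / q.toReal - 1 / p.toReal) := by
      positivity
    linarith
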